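/- Let F be a skew-symmetric endomorphism of Minkowski space 𝕄^{1,d-1}, let e, v ∈ ℝ^d satisfy η(e,v) = 0, η(v,v) = 1 and e ≠ 0, and let G be the endomorphism G(w) = η(v,w)·e - η(e,w)·v. Then F∘G = G∘F if and only if there exists μ ∈ ℝ such that F e = η(e,e)·μ·v and F v = -μ·e. -/

import Mathlib

open scoped BigOperators

/-- The Minkowski bilinear form on `ℝ^d`. -/
noncomputable def mink (d : ℕ) (x y : Fin d → ℝ) : ℝ :=
  ∑ i : Fin d, (if (i : ℕ) = 0 then (-1 : ℝ) else 1) * x i * y i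

/-- Skew-symmetry w.r.t. the Minkowski form. -/
def IsSkew (d : ℕ) (F : (Fin d → ℝ) →ₗ[ℝ] (Fin d → ℝ)) : Prop :=
  ∀ x y, mink d (F x) y = - mink d x (F y)

theorem mink_comm (d : ℕ) (x y : Fin d → ℝ) : mink d x y = mink d y x := by
  unfold mink
  exact Finset.sum_congr rfl fun i _ => by ring

theorem mink_smul_left (d : ℕ) (c : ℝ) (x y : Fin d → ℝ) :
    mink d (c • x) y = c * mink d x y := by
  unfold mink
  rw [Finset.mul_sum]
  exact Finset.sum_congr rfl fun i _ => by simp only [Pi.smul_apply, smul_eq_mul]; ring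

/-- The Minkowski form is nondegenerate. -/
theorem exists_mink_ne_zero (d : ℕ) {x : Fin d → ℝ} (hx : x ≠ 0) : ∃ w, mink d x w ≠ 0 := by
  obtain ⟨i, hi⟩ := Function.ne_iff.mp hx
  refine ⟨Pi.single i 1, ?_⟩
  have h : mink d x (Pi.single i 1) = (if (i : ℕ) = 0 then (-1 : ℝ) else 1) * x i := by
    simp [mink, Pi.single_apply]
  rw [h]
  exact mul_ne_zero (by split_ifs <;> norm_num) hi

theorem IsSkew.mink_self {d : ℕ} {F : (Fin d → ℝ) →ₗ[ℝ] (Fin d → ℝ)} (hF : IsSkew d F)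
    (x : Fin d → ℝ) : mink d (F x) x = 0 := by
  have h := hF x x
  rw [mink_comm d x (F x)] at h
  linarith

/-- Commutation criterion: a skew-symmetric `F` commutes with the simple
endomorphism `G(w) = η(v,w)e - η(e,w)v` iff `F e = η(e,e)μv` and `F v = -μe`
for some `μ ∈ ℝ`. -/
theorem stmt15 (d : ℕ)
    (F G : (Fin d → ℝ) →ₗ[ℝ] (Fin d → ℝ)) (hF : IsSkew d F)
    (e v : Fin d → ℝ) (hev : mink d e v = 0) (hv : mink d v v = 1) (he : e ≠ 0)
    (hG : ∀ w : Fin d → ℝ, G w = mink d v w • e - mink d e w • v) :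
    F ∘ₗ G = G ∘ₗ F ↔
      ∃ μ : ℝ, F e = (mink d e e * μ) • v ∧ F v = (-μ) • e := by
  have hskew (x w : Fin d → ℝ) : mink d x (F w) = -mink d (F x) w := by rw [hF x w, neg_neg]
  have hcomm : F ∘ₗ G = G ∘ₗ F ↔ ∀ w, mink d v w • F e - mink d e w • F v =
      -mink d (F v) w • e + mink d (F e) w • v := by
    simp [LinearMap.ext_iff, hG, hskew, sub_eq_add_neg]
  rw [hcomm]
  constructor
  · intro h
    have hFe : F e = mink d (F e) v • v := by
      simpa [hv, hev, hF.mink_self v] using h v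
    obtain ⟨w, hw⟩ := exists_mink_ne_zero d he
    have hw' : mink d e w • F v = mink d (F v) w • e := by
      have hFew : mink d (F e) w = mink d (F e) v * mink d v w := by
        conv_lhs => rw [hFe]
        exact mink_smul_left d _ _ _
      have hcw := h w
      rw [hFew] at hcw
      have hv' : mink d v w • F e = (mink d (F e) v * mink d v w) • v := by
        conv_lhs => rw [hFe]
        rw [smul_smul, mul_comm]
      rw [hv'] at hcw
      rw [neg_smul, sub_eq_add_neg, add_comm, add_left_inj] at hcw
      exact neg_inj.mp hcw
    have hFv : F v = (mink d (F v) w / mink d e w) • e := by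
      rw [div_eq_inv_mul, mul_smul, ← hw', inv_smul_smul₀ hw]
    refine ⟨-(mink d (F v) w / mink d e w), ?_, by rwa [neg_neg]⟩
    have ha : mink d (F e) v = mink d e e * -(mink d (F v) w / mink d e w) := by
      rw [hF e v, mink_comm d e (F v)]
      conv_lhs => rw [hFv]
      rw [mink_smul_left]
      ring
    rwa [← ha]
  · rintro ⟨μ, h₁, h₂⟩ w
    rw [h₁, h₂, mink_smul_left, mink_smul_left]
    module
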